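/- Let E be a real Banach space, D ⊊ E a domain, and α a c-cone arc (c ≥ 1) joining x, y ∈ D with arclength midpoint x₀. If Z_u, Z_v ∈ α[x,x₀], with Z_v lying on α between Z_u and x₀, satisfy Δ(Z_v) ≤ 2·e^{2R}·Δ(Z_u) for some R ≥ 0, then k_D(Z_u, Z_v) ≤ l_k(α[Z_u,Z_v]) ≤ 3c·log(1 + 2c·e^{2R}). -/

import Mathlib

open Set Metric

noncomputable section

variable {E : Type*} [NormedAddCommGroup E] [NormedSpace ℝ E]

/-- `deltaBd D z` is the distance `Δ(z)` from `z` to the boundary `∂D`. -/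
def deltaBd (D : Set E) (z : E) : ℝ := Metric.infDist z (frontier D)

/-- `γ` is a rectifiable curve in `D`, parametrized by (norm) arclength on `[0, L]`:
it maps `[0, L]` into `D` and the length of the subarc `γ[γ s, γ t]` equals `t - s`. -/
def IsArcLengthParam (D : Set E) (γ : ℝ → E) (L : ℝ) : Prop :=
  0 ≤ L ∧ (∀ t ∈ Icc (0 : ℝ) L, γ t ∈ D) ∧
    ∀ s t : ℝ, 0 ≤ s → s ≤ t → t ≤ L →
      eVariationOn γ (Icc s t) = ENNReal.ofReal (t - s)

/-- The quasihyperbolic length `l_k(γ[γ a, γ b]) = ∫ ds / Δ` of the subarc between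
parameters `a` and `b` of an arclength-parametrized curve `γ` in `D`. -/
def qhLength (D : Set E) (γ : ℝ → E) (a b : ℝ) : ℝ :=
  ∫ t in a..b, 1 / deltaBd D (γ t)

/-- The quasihyperbolic metric `k_D(x,y)`: the infimum of quasihyperbolic lengths of
rectifiable curves in `D` joining `x` and `y`. -/
def qhDist (D : Set E) (x y : E) : ℝ :=
  sInf { l : ℝ | ∃ γ : ℝ → E, ∃ L : ℝ, IsArcLengthParam D γ L ∧
    γ 0 = x ∧ γ L = y ∧ l = qhLength D γ 0 L }

/-- An arclength-parametrized curve `γ : [0,L] → D` joining `x = γ 0` and `y = γ L` is a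
`b`-cone arc if `min (l (γ[x,z])) (l (γ[z,y])) ≤ b * Δ z` for every point `z = γ t` on `γ`. -/
def IsConeArc (D : Set E) (γ : ℝ → E) (L b : ℝ) : Prop :=
  ∀ t ∈ Icc (0 : ℝ) L, min t (L - t) ≤ b * deltaBd D (γ t)

/-- `D` is a `c`-John domain: every pair of points of `D` can be joined by a `c`-cone arc. -/
def IsJohnDomain (D : Set E) (c : ℝ) : Prop :=
  ∀ x ∈ D, ∀ y ∈ D, ∃ γ : ℝ → E, ∃ L : ℝ,
    IsArcLengthParam D γ L ∧ γ 0 = x ∧ γ L = y ∧ IsConeArc D γ L c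

/-- A curve `γ` in `D` is a `c₀`-neargeodesic if `l_k(γ[x,y]) ≤ c₀ * k_D(x,y)` for all
points `x, y` on `γ`. -/
def IsNeargeodesic (D : Set E) (γ : ℝ → E) (L c₀ : ℝ) : Prop :=
  IsArcLengthParam D γ L ∧
    ∀ s t : ℝ, 0 ≤ s → s ≤ t → t ≤ L →
      qhLength D γ s t ≤ c₀ * qhDist D (γ s) (γ t)

/-- The Gromov product `(x|y)_p` with respect to the quasihyperbolic metric on `D`. -/
def gromovProd (D : Set E) (p x y : E) : ℝ :=
  (qhDist D x p + qhDist D y p - qhDist D x y) / 2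

/-- `(D, k_D)` is Gromov `δ`-hyperbolic. -/
def IsGromovHyperbolic (D : Set E) (δ : ℝ) : Prop :=
  ∀ x ∈ D, ∀ y ∈ D, ∀ z ∈ D, ∀ p ∈ D,
    min (gromovProd D p x y) (gromovProd D p y z) - δ ≤ gromovProd D p x z

end

theorem deltaBd_nonneg {E : Type*} [NormedAddCommGroup E] [NormedSpace ℝ E] (D : Set E) (z : E) :
    0 ≤ deltaBd D z :=
  Metric.infDist_nonneg

theorem deltaBd_pos {E : Type*} [NormedAddCommGroup E] [NormedSpace ℝ E] {D : Set E}
    (hD : IsOpen D) (hne : D ≠ Set.univ) {z : E} (hz : z ∈ D) : 0 < deltaBd D z := by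
  have hfr : (frontier D).Nonempty := nonempty_frontier_iff.2 ⟨⟨z, hz⟩, hne⟩
  refine (isClosed_frontier.notMem_iff_infDist_pos hfr).1 fun h => ?_
  rw [hD.frontier_eq] at h
  exact h.2 hz

theorem qhLength_nonneg {E : Type*} [NormedAddCommGroup E] [NormedSpace ℝ E] (D : Set E) (γ : ℝ → E) {a b : ℝ}
    (hab : a ≤ b) : 0 ≤ qhLength D γ a b :=
  intervalIntegral.integral_nonneg hab fun _ _ => one_div_nonneg.2 (deltaBd_nonneg _ _)

theorem IsArcLengthParam.dist_le {E : Type*} [NormedAddCommGroup E] [NormedSpace ℝ E] {D : Set E}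
    {γ : ℝ → E} {L : ℝ} (h : IsArcLengthParam D γ L) {a b : ℝ} (ha : 0 ≤ a) (hab : a ≤ b)
    (hb : b ≤ L) : dist (γ a) (γ b) ≤ b - a := by
  have h1 := eVariationOn.edist_le γ (left_mem_Icc.2 hab) (right_mem_Icc.2 hab)
  rw [h.2.2 a b ha hab hb, edist_dist] at h1
  exact (ENNReal.ofReal_le_ofReal_iff (sub_nonneg.2 hab)).1 h1

/-- A subarc of an arclength-parametrized curve, shifted to start at parameter `0`. -/
theorem IsArcLengthParam.subarc {E : Type*} [NormedAddCommGroup E] [NormedSpace ℝ E] {D : Set E}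
    {γ : ℝ → E} {L : ℝ} (h : IsArcLengthParam D γ L) {a b : ℝ} (ha : 0 ≤ a) (hab : a ≤ b)
    (hb : b ≤ L) : IsArcLengthParam D (fun r => γ (r + a)) (b - a) := by
  refine ⟨sub_nonneg.2 hab, fun r hr => h.2.1 _ ⟨by linarith [hr.1], by linarith [hr.2]⟩, ?_⟩
  intro p q hp hpq hq
  have hcomp := eVariationOn.comp_eq_of_monotoneOn γ (t := Icc p q) (fun r => r + a)
    (fun _ _ _ _ hxy => by simpa using hxy)
  rw [Set.image_add_const_Icc, h.2.2 _ _ (by linarith) (by linarith) (by linarith)] at hcomp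
  rw [show q - p = q + a - (p + a) by ring, ← hcomp]
  rfl

theorem qhDist_le_qhLength {E : Type*} [NormedAddCommGroup E] [NormedSpace ℝ E] {D : Set E}
    {γ : ℝ → E} {L : ℝ} (h : IsArcLengthParam D γ L) {a b : ℝ} (ha : 0 ≤ a) (hab : a ≤ b)
    (hb : b ≤ L) : qhDist D (γ a) (γ b) ≤ qhLength D γ a b := by
  refine csInf_le ⟨0, ?_⟩ ⟨_, b - a, h.subarc ha hab hb, by simp, by simp, ?_⟩
  · rintro _ ⟨β, M, hβ, -, -, rfl⟩
    exact qhLength_nonneg D β hβ.1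
  · have hshift := intervalIntegral.integral_comp_add_right (a := 0) (b := b - a)
      (fun r => 1 / deltaBd D (γ r)) a
    rw [zero_add, sub_add_cancel] at hshift
    exact hshift.symm

/-- On the first half of a cone arc the distance to the boundary grows at least linearly. -/
theorem IsConeArc.add_sub_le_mul_deltaBd {E : Type*} [NormedAddCommGroup E] [NormedSpace ℝ E] {D : Set E}
    {γ : ℝ → E} {L c : ℝ} (h : IsArcLengthParam D γ L) (hcone : IsConeArc D γ L c) {a r : ℝ}
    (ha : 0 ≤ a) (har : a ≤ r) (hr : r ≤ L / 2) :
    deltaBd D (γ a) + (r - a) ≤ (1 + 2 * c) * deltaBd D (γ r) := by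
  have hc := hcone r ⟨by linarith, by linarith⟩
  rw [min_eq_left (by linarith)] at hc
  have hlip : deltaBd D (γ a) ≤ deltaBd D (γ r) + dist (γ a) (γ r) :=
    Metric.infDist_le_infDist_add_dist
  have hdist := h.dist_le ha har (by linarith)
  linarith

theorem integral_one_div_add_sub {d a b : ℝ} (hd : 0 < d) (hab : a ≤ b) :
    ∫ r in a..b, 1 / (d + (r - a)) = Real.log (1 + (b - a) / d) := by
  have hshift := intervalIntegral.integral_comp_add_right (a := a) (b := b)
    (fun r : ℝ => 1 / r) (d - a)
  rw [integral_one_div_of_pos (by linarith) (by linarith)] at hshift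
  calc ∫ r in a..b, 1 / (d + (r - a)) = ∫ r in a..b, 1 / (r + (d - a)) := by
        congr 1; ext r; congr 1; ring
    _ = Real.log (1 + (b - a) / d) := by
        rw [hshift]; congr 1; rw [add_sub_cancel]; field_simp; ring

theorem IsConeArc.qhLength_le {E : Type*} [NormedAddCommGroup E] [NormedSpace ℝ E] {D : Set E}
    (hD : IsOpen D) (hne : D ≠ Set.univ) {γ : ℝ → E} {L c : ℝ}
    (h : IsArcLengthParam D γ L) (hcone : IsConeArc D γ L c) {a b : ℝ}
    (ha : 0 ≤ a) (hab : a ≤ b) (hb : b ≤ L / 2) :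
    qhLength D γ a b ≤ (1 + 2 * c) * Real.log (1 + (b - a) / deltaBd D (γ a)) := by
  have hpos : ∀ r, 0 ≤ r → r ≤ L / 2 → 0 < deltaBd D (γ r) := fun r h0 h1 =>
    deltaBd_pos hD hne (h.2.1 r ⟨h0, by linarith⟩)
  have hda := hpos a ha (hab.trans hb)
  rw [← integral_one_div_add_sub hda hab, ← intervalIntegral.integral_const_mul, qhLength,
    intervalIntegral.integral_of_le hab, intervalIntegral.integral_of_le hab]
  refine MeasureTheory.integral_mono_of_nonneg
    (Filter.Eventually.of_forall fun r => one_div_nonneg.2 (deltaBd_nonneg _ _)) ?_ ?_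
  · refine (intervalIntegrable_iff_integrableOn_Ioc_of_le hab).1 ?_
    refine ContinuousOn.intervalIntegrable_of_Icc hab ?_
    refine continuousOn_const.mul (continuousOn_const.div (by fun_prop) fun r hr => ?_)
    linarith [hr.1]
  · refine (MeasureTheory.ae_restrict_iff' measurableSet_Ioc).2
      (Filter.Eventually.of_forall fun r hr => ?_)
    have hr0 := hpos r (ha.trans hr.1.le) (hr.2.trans hb)
    have hgrow := hcone.add_sub_le_mul_deltaBd h ha hr.1.le (hr.2.trans hb)
    have hden : 0 < deltaBd D (γ a) + (r - a) := by linarith [hr.1]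
    change 1 / deltaBd D (γ r) ≤ (1 + 2 * c) * (1 / (deltaBd D (γ a) + (r - a)))
    rw [mul_one_div, div_le_div_iff₀ hr0 hden, one_mul]
    exact hgrow

/-- Let `D ⊊ E` be a domain and `α` a `c`-cone arc (`c ≥ 1`) joining
`x, y ∈ D` with arclength midpoint `x₀ = α (L/2)`. If `Z_u = α s`, `Z_v = α t` lie on
`α[x,x₀]` with `Z_v` between `Z_u` and `x₀`, and `Δ(Z_v) ≤ 2 * e^(2R) * Δ(Z_u)` for some
`R ≥ 0`, then `k_D(Z_u, Z_v) ≤ l_k(α[Z_u, Z_v]) ≤ 3c * log (1 + 2c * e^(2R))`. -/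
theorem cone_arc_qhDist_estimate_between_comparable_points
    {E : Type*} [NormedAddCommGroup E] [NormedSpace ℝ E] [CompleteSpace E]
    (D : Set E) (hD : IsOpen D) (hconn : IsConnected D) (hne : D ≠ Set.univ)
    (c : ℝ) (hc : 1 ≤ c) (α : ℝ → E) (L : ℝ) (x y : E)
    (hα : IsArcLengthParam D α L) (hx : α 0 = x) (hy : α L = y)
    (hcone : IsConeArc D α L c)
    (R : ℝ) (hR : 0 ≤ R)
    (s t : ℝ) (hs : 0 ≤ s) (hst : s ≤ t) (ht : t ≤ L / 2)
    (hΔ : deltaBd D (α t) ≤ 2 * Real.exp (2 * R) * deltaBd D (α s)) :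
    qhDist D (α s) (α t) ≤ qhLength D α s t ∧
    qhLength D α s t ≤ 3 * c * Real.log (1 + 2 * c * Real.exp (2 * R)) := by
  have hL := hα.1
  refine ⟨qhDist_le_qhLength hα hs hst (by linarith), ?_⟩
  have hds : 0 < deltaBd D (α s) := deltaBd_pos hD hne (hα.2.1 s ⟨hs, by linarith⟩)
  have hct := hcone t ⟨by linarith, by linarith⟩
  rw [min_eq_left (by linarith)] at hct
  have hratio : (t - s) / deltaBd D (α s) ≤ 2 * c * Real.exp (2 * R) := by
    rw [div_le_iff₀ hds]
    have hmul := mul_le_mul_of_nonneg_left hΔ (by linarith : 0 ≤ c)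
    linarith
  have hfrac : 0 ≤ (t - s) / deltaBd D (α s) := div_nonneg (sub_nonneg.2 hst) hds.le
  calc qhLength D α s t
      ≤ (1 + 2 * c) * Real.log (1 + (t - s) / deltaBd D (α s)) :=
        hcone.qhLength_le hD hne hα hs hst ht
    _ ≤ 3 * c * Real.log (1 + 2 * c * Real.exp (2 * R)) := by
        refine mul_le_mul (by linarith) (Real.log_le_log (by linarith) (by linarith))
          (Real.log_nonneg (by linarith)) (by linarith)
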